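/- arXiv:1905.08998 — 7 statements merged into one kernel-verified Lean document; each statement's English description precedes it below -/
import Mathlib

section
/- Let z ∈ ℝ^{2m} lie in the column span of 𝓑 and let w ∈ ℝ^n be a solution of the measurement system for z in 𝒲 = ℝ^n. Then w is the unique solution of the measurement system for z in ℝ^n if and only if G is not bipartite. -/
open Matrix

/-- Head incidence matrix `B₊` for the orientation with head map `hd`. -/
def Bplus {n : ℕ} (G : SimpleGraph (Fin n)) (hd : G.edgeSet → Fin n) :
    Matrix G.edgeSet (Fin n) ℝ :=
  Matrix.of fun e i => if i = hd e then (1 : ℝ) else 0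

/-- Tail incidence matrix `B₋` for the orientation with tail map `tl`. -/
def Bminus {n : ℕ} (G : SimpleGraph (Fin n)) (tl : G.edgeSet → Fin n) :
    Matrix G.edgeSet (Fin n) ℝ :=
  Matrix.of fun e i => if i = tl e then (-1 : ℝ) else 0

/-- `hd, tl` form an orientation of `G`: the head and tail of each edge are its two
(distinct) endpoints. -/
def IsOrientation {n : ℕ} (G : SimpleGraph (Fin n)) (hd tl : G.edgeSet → Fin n) : Prop :=
  ∀ e : G.edgeSet, hd e ≠ tl e ∧ (e : Sym2 (Fin n)) = s(hd e, tl e)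

/-- `w̄` solves the measurement system `ζ = -B x̄ + B₊ w̄`, `η = B x̄ - B₋ w̄`
for the data `z = (ζ, η)`, where `B = B₊ + B₋`. -/
def Solves {n : ℕ} (G : SimpleGraph (Fin n)) (hd tl : G.edgeSet → Fin n)
    (ζ η : G.edgeSet → ℝ) (wbar : Fin n → ℝ) : Prop :=
  ∃ xbar : Fin n → ℝ,
    ζ = -((Bplus G hd + Bminus G tl) *ᵥ xbar) + Bplus G hd *ᵥ wbar ∧
    η = (Bplus G hd + Bminus G tl) *ᵥ xbar - Bminus G tl *ᵥ wbar

/-- `G` is bipartite. -/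
def IsBipartite {n : ℕ} (G : SimpleGraph (Fin n)) : Prop :=
  ∃ Vp Vm : Set (Fin n), Disjoint Vp Vm ∧ Vp ∪ Vm = Set.univ ∧
    ∀ ⦃u v : Fin n⦄, G.Adj u v → (u ∈ Vp ∧ v ∈ Vm) ∨ (u ∈ Vm ∧ v ∈ Vp)

/-- The measurement system, read edge by edge. -/
lemma solves_iff_forall_edge {n : ℕ} (G : SimpleGraph (Fin n)) (hd tl : G.edgeSet → Fin n)
    (ζ η : G.edgeSet → ℝ) (w : Fin n → ℝ) :
    Solves G hd tl ζ η w ↔ ∃ x : Fin n → ℝ, ∀ e,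
      ζ e = -(x (hd e) - x (tl e)) + w (hd e) ∧ η e = (x (hd e) - x (tl e)) + w (tl e) := by
  simp only [Solves, funext_iff, ← forall_and]
  refine exists_congr fun x => forall_congr' fun e => ?_
  simp [Bplus, Bminus, Matrix.mulVec, dotProduct, add_mul, Finset.sum_add_distrib, sub_eq_add_neg]

/-- For the same data, a second vector is a solution exactly when it has the same sums over the
endpoints of edges, that is, when the signless incidence matrix annihilates the difference. -/
lemma Solves.solves_iff_adj {n : ℕ} {G : SimpleGraph (Fin n)} {hd tl : G.edgeSet → Fin n}
    (horient : IsOrientation G hd tl) {ζ η : G.edgeSet → ℝ} {w : Fin n → ℝ}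
    (hw : Solves G hd tl ζ η w) (w' : Fin n → ℝ) :
    Solves G hd tl ζ η w' ↔ ∀ u v, G.Adj u v → w' u + w' v = w u + w v := by
  rw [solves_iff_forall_edge] at hw ⊢
  obtain ⟨x, hx⟩ := hw
  constructor
  · rintro ⟨x', hx'⟩ u v huv
    let e : G.edgeSet := ⟨s(u, v), huv⟩
    have h : s(u, v) = s(hd e, tl e) := (horient e).2
    have h1 := hx e
    have h2 := hx' e
    rcases Sym2.eq_iff.mp h with ⟨hu, hv⟩ | ⟨hu, hv⟩ <;> rw [hu, hv] <;> linarith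
  · intro h
    refine ⟨fun i => x i + (w' i - w i) / 2, fun e => ?_⟩
    have hadj : G.Adj (hd e) (tl e) := by
      rw [← SimpleGraph.mem_edgeSet, ← (horient e).2]
      exact e.2
    have h1 := hx e
    have h2 := h _ _ hadj
    constructor <;> dsimp only <;> linarith

/-- On a connected graph that is not bipartite, the kernel of the signless incidence matrix is
trivial. -/
lemma eq_zero_of_add_eq_zero_of_adj {n : ℕ} {G : SimpleGraph (Fin n)} (hconn : G.Connected)
    (hG : ¬ IsBipartite G) {d : Fin n → ℝ} (hadj : ∀ u v, G.Adj u v → d u + d v = 0) :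
    d = 0 := by
  have habs : ∀ u v, |d u| = |d v| := fun u v => by
    obtain ⟨p⟩ := hconn.preconnected u v
    induction p with
    | nil => rfl
    | cons h _ ih => rw [← ih, eq_neg_of_add_eq_zero_left (hadj _ _ h), abs_neg]
  by_contra hd
  obtain ⟨i, hi⟩ := Function.ne_iff.mp hd
  have hne : ∀ u, d u ≠ 0 := fun u => by
    rw [← abs_pos, habs u i]
    exact abs_pos.mpr hi
  refine hG ⟨{u | 0 < d u}, {u | 0 < d u}ᶜ, disjoint_compl_right, Set.union_compl_self _,
    fun u v huv => ?_⟩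
  have huv := hadj u v huv
  simp only [Set.mem_ofPred_eq, Set.mem_compl_iff, not_lt]
  rcases (hne u).lt_or_gt with h | h
  · exact Or.inr ⟨h.le, by linarith⟩
  · exact Or.inl ⟨h, by linarith⟩

/-- On a nonempty bipartite graph, the signless incidence matrix has a nonzero kernel vector. -/
lemma IsBipartite.exists_ne_zero_add_eq_zero {n : ℕ} [NeZero n] {G : SimpleGraph (Fin n)}
    (hG : IsBipartite G) : ∃ d : Fin n → ℝ, d ≠ 0 ∧ ∀ u v, G.Adj u v → d u + d v = 0 := by
  classical
  obtain ⟨Vp, Vm, hdisj, -, hE⟩ := hG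
  refine ⟨fun i => if i ∈ Vp then 1 else -1, fun h => ?_, fun u v huv => ?_⟩
  · have h0 := congrFun h 0
    by_cases hp : (0 : Fin n) ∈ Vp <;> simp [hp] at h0
  · rcases hE huv with ⟨hu, hv⟩ | ⟨hu, hv⟩
    · simp [hu, hdisj.notMem_of_mem_right hv]
    · simp [hv, hdisj.notMem_of_mem_right hu]

/-- a solution `w` of the measurement system (with `𝒲 = ℝⁿ`) is unique
if and only if `G` is not bipartite. -/
theorem stmt8 {n : ℕ} (hn : 2 ≤ n) (G : SimpleGraph (Fin n)) (hconn : G.Connected)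
    (hd tl : G.edgeSet → Fin n) (horient : IsOrientation G hd tl)
    (ζ η : G.edgeSet → ℝ) (w : Fin n → ℝ) (hw : Solves G hd tl ζ η w) :
    (∀ w' : Fin n → ℝ, Solves G hd tl ζ η w' → w' = w) ↔ ¬ IsBipartite G := by
  simp only [hw.solves_iff_adj horient]
  constructor
  · intro h hG
    have : NeZero n := ⟨by omega⟩
    obtain ⟨d, hne, hadj⟩ := hG.exists_ne_zero_add_eq_zero
    refine hne (add_eq_left.mp (h (w + d) fun u v huv => ?_))
    have := hadj u v huv
    simp only [Pi.add_apply]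
    linarith
  · intro hG w' h
    refine sub_eq_zero.mp (eq_zero_of_add_eq_zero_of_adj hconn hG fun u v huv => ?_)
    have := h u v huv
    simp only [Pi.sub_apply]
    linarith
end

section
/- Suppose G is not bipartite. Then every solution e : [0, ∞) → ℝ^n of the linear differential equation ė(t) = −(A + D) e(t) converges to 0 exponentially fast: there exist constants c > 0 and α > 0 (independent of the initial condition) such that ‖e(t)‖ ≤ c e^{−α t} ‖e(0)‖ for all t ≥ 0. -/
open Matrix

namespace SimpleGraph

/-- The quadratic form of the signless Laplacian is the sum of `(x i + x j) ^ 2` over the edges. -/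
theorem dotProduct_signlessLaplacian_mulVec {V : Type*} [Fintype V] [DecidableEq V]
    (G : SimpleGraph V) [DecidableRel G.Adj] (x : V → ℝ) :
    x ⬝ᵥ ((G.adjMatrix ℝ + Matrix.diagonal (fun i => (G.degree i : ℝ))) *ᵥ x) =
      (∑ i, ∑ j, if G.Adj i j then (x i + x j) ^ 2 else 0) / 2 := by
  have hA : x ⬝ᵥ (G.adjMatrix ℝ *ᵥ x) = ∑ i, ∑ j, if G.Adj i j then x i * x j else 0 :=
    dotProduct_mulVec_adjMatrix ..
  have hD : x ⬝ᵥ (Matrix.diagonal (fun i => (G.degree i : ℝ)) *ᵥ x) =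
      ∑ i, ∑ j, if G.Adj i j then x i ^ 2 else 0 := by
    simp only [dotProduct, mulVec_diagonal]
    refine Finset.sum_congr rfl fun i _ => ?_
    rw [degree_eq_sum_if_adj, Finset.sum_mul, Finset.mul_sum]
    refine Finset.sum_congr rfl fun j _ => ?_
    split_ifs <;> ring
  have hswap : (∑ i, ∑ j, if G.Adj i j then x i ^ 2 else 0) =
      ∑ i, ∑ j, if G.Adj i j then x j ^ 2 else 0 := by
    rw [Finset.sum_comm]
    simp only [G.adj_comm]
  have hsum : (∑ i, ∑ j, if G.Adj i j then (x i + x j) ^ 2 else 0) =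
      2 * (∑ i, ∑ j, if G.Adj i j then x i * x j else 0) +
        (∑ i, ∑ j, if G.Adj i j then x i ^ 2 else 0) +
        ∑ i, ∑ j, if G.Adj i j then x j ^ 2 else 0 := by
    simp only [Finset.mul_sum, ← Finset.sum_add_distrib]
    refine Finset.sum_congr rfl fun i _ => Finset.sum_congr rfl fun j _ => ?_
    split_ifs <;> ring
  rw [add_mulVec, dotProduct_add, hA, hD, hsum, ← hswap]
  ring

theorem Connected.abs_eq_of_adj_eq_neg {V : Type*} {G : SimpleGraph V} (hG : G.Connected)
    {x : V → ℝ}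
    (hx : ∀ i j, G.Adj i j → x i = -x j) (i j : V) : |x i| = |x j| := by
  obtain ⟨p⟩ := hG.preconnected i j
  induction p with
  | nil => rfl
  | cons h _ ih => rw [hx _ _ h, abs_neg, ih]

end SimpleGraph

theorem dotProduct_signlessLaplacian_mulVec_pos {n : ℕ} {G : SimpleGraph (Fin n)}
    [DecidableRel G.Adj] (hconn : G.Connected) (hnbip : ¬ IsBipartite G)
    {x : Fin n → ℝ} (hx : x ≠ 0) :
    0 < x ⬝ᵥ ((G.adjMatrix ℝ + Matrix.diagonal (fun i => (G.degree i : ℝ))) *ᵥ x) := by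
  rw [G.dotProduct_signlessLaplacian_mulVec]
  have hterm : ∀ i j, 0 ≤ if G.Adj i j then (x i + x j) ^ 2 else 0 := fun i j => by
    split_ifs <;> positivity
  have hrow : ∀ i, 0 ≤ ∑ j, if G.Adj i j then (x i + x j) ^ 2 else 0 := fun i =>
    Finset.sum_nonneg fun j _ => hterm i j
  refine half_pos ((Finset.sum_nonneg fun i _ => hrow i).lt_of_ne' fun h0 => hnbip ?_)
  have hneg : ∀ i j, G.Adj i j → x i = -x j := fun i j hij => by
    have hi := (Finset.sum_eq_zero_iff_of_nonneg fun i _ => hrow i).1 h0 i (Finset.mem_univ i)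
    have hj := (Finset.sum_eq_zero_iff_of_nonneg fun j _ => hterm i j).1 hi j (Finset.mem_univ j)
    rw [if_pos hij, sq_eq_zero_iff] at hj
    linarith
  obtain ⟨k, hk⟩ := Function.ne_iff.1 hx
  have hne : ∀ i, x i ≠ 0 := fun i => by
    rw [← abs_pos, hconn.abs_eq_of_adj_eq_neg hneg i k, abs_pos]
    exact hk
  refine ⟨{i | 0 < x i}, {i | x i < 0}, ?_, ?_, fun u v huv => ?_⟩
  · exact Set.disjoint_left.2 fun i (hi : 0 < x i) (hi' : x i < 0) => lt_asymm hi hi'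
  · ext i
    simpa using (hne i).lt_or_gt.symm
  · have huv' := hneg u v huv
    rcases (hne u).lt_or_gt with h | h
    · exact Or.inr ⟨h, by simp only [Set.mem_ofPred_eq]; linarith⟩
    · exact Or.inl ⟨h, by simp only [Set.mem_ofPred_eq]; linarith⟩

section LinearFlow

variable {ι : Type*} [Fintype ι]

theorem dotProduct_self_le_card_mul_norm_sq (x : ι → ℝ) :
    x ⬝ᵥ x ≤ Fintype.card ι * ‖x‖ ^ 2 := by
  have h : ∀ i ∈ Finset.univ, x i * x i ≤ ‖x‖ ^ 2 := fun i _ => by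
    rw [← abs_mul_abs_self, ← sq]
    exact pow_le_pow_left₀ (abs_nonneg _) (norm_le_pi_norm x i) 2
  simpa [dotProduct] using Finset.sum_le_card_nsmul _ _ _ h

theorem norm_sq_le_dotProduct_self (x : ι → ℝ) : ‖x‖ ^ 2 ≤ x ⬝ᵥ x := by
  have h0 : 0 ≤ x ⬝ᵥ x := Finset.sum_nonneg fun i _ => mul_self_nonneg (x i)
  refine (Real.le_sqrt (norm_nonneg x) h0).1
    ((pi_norm_le_iff_of_nonneg (Real.sqrt_nonneg _)).2 fun i => Real.le_sqrt_of_sq_le ?_)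
  rw [Real.norm_eq_abs, sq_abs, sq]
  exact Finset.single_le_sum (f := fun i => x i * x i) (fun i _ => mul_self_nonneg (x i))
    (Finset.mem_univ i)

/-- A positive definite quadratic form is coercive. -/
theorem exists_pos_mul_dotProduct_self_le [Nonempty ι] (Q : Matrix ι ι ℝ)
    (hQ : ∀ x : ι → ℝ, x ≠ 0 → 0 < x ⬝ᵥ (Q *ᵥ x)) :
    ∃ α > (0 : ℝ), ∀ x : ι → ℝ, α * (x ⬝ᵥ x) ≤ x ⬝ᵥ (Q *ᵥ x) := by
  have hcont : Continuous fun x : ι → ℝ => x ⬝ᵥ (Q *ᵥ x) := by fun_prop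
  obtain ⟨y, hy, hmin⟩ := (isCompact_sphere (0 : ι → ℝ) 1).exists_isMinOn
    (NormedSpace.sphere_nonempty.2 zero_le_one) hcont.continuousOn
  have hy0 : 0 < y ⬝ᵥ (Q *ᵥ y) := hQ y (ne_zero_of_mem_unit_sphere ⟨y, hy⟩)
  have hcard : (0 : ℝ) < Fintype.card ι := by exact_mod_cast Fintype.card_pos
  refine ⟨y ⬝ᵥ (Q *ᵥ y) / Fintype.card ι, by positivity, fun x => ?_⟩
  have hle : y ⬝ᵥ (Q *ᵥ y) * ‖x‖ ^ 2 ≤ x ⬝ᵥ (Q *ᵥ x) := by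
    rcases eq_or_ne x 0 with rfl | hx
    · simp
    have hx' : 0 < ‖x‖ := norm_pos_iff.2 hx
    have hmem : ‖x‖⁻¹ • x ∈ Metric.sphere (0 : ι → ℝ) 1 := by
      simp [norm_smul, hx'.ne']
    have h : y ⬝ᵥ (Q *ᵥ y) ≤ (‖x‖⁻¹ • x) ⬝ᵥ (Q *ᵥ (‖x‖⁻¹ • x)) := hmin hmem
    rw [mulVec_smul, smul_dotProduct, dotProduct_smul, smul_eq_mul, smul_eq_mul] at h
    calc y ⬝ᵥ (Q *ᵥ y) * ‖x‖ ^ 2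
        ≤ ‖x‖⁻¹ * (‖x‖⁻¹ * x ⬝ᵥ (Q *ᵥ x)) * ‖x‖ ^ 2 := by gcongr
      _ = x ⬝ᵥ (Q *ᵥ x) := by field_simp
  refine le_trans ?_ hle
  rw [div_mul_eq_mul_div, div_le_iff₀ hcard, mul_assoc, mul_comm (‖x‖ ^ 2)]
  exact mul_le_mul_of_nonneg_left (dotProduct_self_le_card_mul_norm_sq x) hy0.le

theorem dotProduct_self_le_exp_mul_of_hasDerivAt {Q : Matrix ι ι ℝ} {α : ℝ}
    (hα : ∀ x : ι → ℝ, α * (x ⬝ᵥ x) ≤ x ⬝ᵥ (Q *ᵥ x)) {e : ℝ → ι → ℝ}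
    (he : ∀ t : ℝ, 0 ≤ t → HasDerivAt e (-(Q *ᵥ e t)) t) {t : ℝ} (ht : 0 ≤ t) :
    e t ⬝ᵥ e t ≤ Real.exp (-α * t) ^ 2 * (e 0 ⬝ᵥ e 0) := by
  have hsq : ∀ s, 0 ≤ s →
      HasDerivAt (fun s => e s ⬝ᵥ e s) (-2 * (e s ⬝ᵥ (Q *ᵥ e s))) s := fun s hs => by
    have hcoord := hasDerivAt_pi.1 (he s hs)
    refine (HasDerivAt.fun_sum (u := Finset.univ) fun i _ =>
      (hcoord i).mul (hcoord i)).congr_deriv ?_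
    simp only [dotProduct, Finset.mul_sum, Pi.neg_apply]
    exact Finset.sum_congr rfl fun i _ => by ring
  have hderiv : ∀ s, 0 ≤ s → HasDerivAt (fun s => Real.exp (2 * α * s) * (e s ⬝ᵥ e s))
      (2 * Real.exp (2 * α * s) * (α * (e s ⬝ᵥ e s) - e s ⬝ᵥ (Q *ᵥ e s))) s := fun s hs => by
    refine ((((hasDerivAt_id s).const_mul (2 * α)).exp).mul (hsq s hs)).congr_deriv ?_
    simp only [id]
    ring
  have hanti : AntitoneOn (fun s => Real.exp (2 * α * s) * (e s ⬝ᵥ e s)) (Set.Ici 0) := by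
    refine antitoneOn_of_hasDerivWithinAt_nonpos (convex_Ici 0)
      (fun s hs => (hderiv s hs).continuousAt.continuousWithinAt)
      (fun s hs => (hderiv s (interior_subset hs)).hasDerivWithinAt) fun s _ => ?_
    exact mul_nonpos_of_nonneg_of_nonpos (by positivity) (sub_nonpos.2 (hα _))
  have h := hanti (Set.mem_Ici.2 le_rfl) (Set.mem_Ici.2 ht) ht
  simp only [mul_zero, Real.exp_zero, one_mul] at h
  have hexp : Real.exp (-α * t) ^ 2 * Real.exp (2 * α * t) = 1 := by
    rw [← Real.exp_nat_mul, ← Real.exp_add, Real.exp_eq_one_iff]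
    push_cast
    ring
  calc e t ⬝ᵥ e t
      = Real.exp (-α * t) ^ 2 * (Real.exp (2 * α * t) * (e t ⬝ᵥ e t)) := by
        rw [← mul_assoc, hexp, one_mul]
    _ ≤ Real.exp (-α * t) ^ 2 * (e 0 ⬝ᵥ e 0) := by gcongr

end LinearFlow

/-- if `G` is not bipartite, every solution of `ė = -(A + D) e` converges
to `0` exponentially fast, with constants independent of the initial condition. -/
theorem stmt9 {n : ℕ} (hn : 2 ≤ n) (G : SimpleGraph (Fin n)) [DecidableRel G.Adj]
    (hconn : G.Connected) (hnbip : ¬ IsBipartite G)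
    (Q : Matrix (Fin n) (Fin n) ℝ)
    (hQ : Q = G.adjMatrix ℝ + Matrix.diagonal (fun i => (G.degree i : ℝ))) :
    ∃ c > (0 : ℝ), ∃ α > (0 : ℝ), ∀ e : ℝ → (Fin n → ℝ),
      (∀ t : ℝ, 0 ≤ t → HasDerivAt e (-(Q *ᵥ e t)) t) →
      ∀ t : ℝ, 0 ≤ t → ‖e t‖ ≤ c * Real.exp (-α * t) * ‖e 0‖ := by
  have : Nonempty (Fin n) := hconn.nonempty
  obtain ⟨α, hα, hcoer⟩ := exists_pos_mul_dotProduct_self_le Q fun x hx => by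
    rw [hQ]
    exact dotProduct_signlessLaplacian_mulVec_pos hconn hnbip hx
  have hn0 : (0 : ℝ) < n := by exact_mod_cast (by omega : 0 < n)
  refine ⟨√n, Real.sqrt_pos.2 hn0, α, hα, fun e he t ht => ?_⟩
  refine le_of_sq_le_sq ?_ (by positivity)
  calc ‖e t‖ ^ 2 ≤ e t ⬝ᵥ e t := norm_sq_le_dotProduct_self _
    _ ≤ Real.exp (-α * t) ^ 2 * (e 0 ⬝ᵥ e 0) :=
        dotProduct_self_le_exp_mul_of_hasDerivAt hcoer he ht
    _ ≤ Real.exp (-α * t) ^ 2 * (n * ‖e 0‖ ^ 2) := by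
        gcongr
        simpa using dotProduct_self_le_card_mul_norm_sq (e 0)
    _ = (√n * Real.exp (-α * t) * ‖e 0‖) ^ 2 := by
        rw [mul_pow, mul_pow, Real.sq_sqrt hn0.le]
        ring
end

section
/- Suppose G is not bipartite and let (e, x) : [0, ∞) → ℝ^n × ℝ^n solve the coupled linear system ė(t) = −(A + D) e(t), ẋ(t) = −L x(t) − D e(t). Then e(t) converges exponentially to 0 and x(t) converges exponentially to a consensus vector x* = c·𝟙_n for some constant c ∈ ℝ. Moreover, if e(0) = −w for some w ∈ ℝ^n, then c = (1/n)·𝟙_n^⊤ D (A + D)^{−1} w + (1/n)·𝟙_n^⊤ x(0). -/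
open Matrix

lemma exists_mul_dotProduct_self_le {ι : Type*} [Fintype ι] (M : Matrix ι ι ℝ)
    (hM : ∀ v : ι → ℝ, v ≠ 0 → 0 < v ⬝ᵥ (M *ᵥ v)) :
    ∃ r > (0 : ℝ), ∀ v : ι → ℝ, r * (v ⬝ᵥ v) ≤ v ⬝ᵥ (M *ᵥ v) := by
  classical
  rcases isEmpty_or_nonempty ι with hι | hι
  · exact ⟨1, one_pos, fun v => by simp [dotProduct]⟩
  have hcont : Continuous fun v : ι → ℝ => v ⬝ᵥ (M *ᵥ v) := by fun_prop
  obtain ⟨u, hu, hmin⟩ := (isCompact_sphere (0 : ι → ℝ) 1).exists_isMinOn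
    (NormedSpace.sphere_nonempty.mpr zero_le_one) hcont.continuousOn
  have hu0 : u ≠ 0 := by
    rintro rfl
    simp at hu
  have hm := hM u hu0
  have hcard : (0 : ℝ) < Fintype.card ι := by exact_mod_cast Fintype.card_pos
  refine ⟨(u ⬝ᵥ (M *ᵥ u)) / Fintype.card ι, div_pos hm hcard, fun v => ?_⟩
  by_cases hv : v = 0
  · simp [hv]
  have hnv : 0 < ‖v‖ := norm_pos_iff.mpr hv
  have hle : u ⬝ᵥ (M *ᵥ u) ≤ (‖v‖⁻¹ • v) ⬝ᵥ (M *ᵥ (‖v‖⁻¹ • v)) :=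
    hmin (by simp [norm_smul, hnv.ne'])
  simp only [mulVec_smul, smul_dotProduct, dotProduct_smul, smul_eq_mul] at hle
  have hle' : (u ⬝ᵥ (M *ᵥ u)) * ‖v‖ ^ 2 ≤ v ⬝ᵥ (M *ᵥ v) := by
    calc _ ≤ (‖v‖⁻¹ * (‖v‖⁻¹ * v ⬝ᵥ (M *ᵥ v))) * ‖v‖ ^ 2 := by gcongr
      _ = _ := by field_simp
  have hvv : v ⬝ᵥ v ≤ Fintype.card ι * ‖v‖ ^ 2 := by
    calc v ⬝ᵥ v ≤ ∑ _i : ι, ‖v‖ ^ 2 := by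
          refine Finset.sum_le_sum fun i _ => ?_
          rw [← sq, ← sq_abs]
          exact pow_le_pow_left₀ (abs_nonneg _) (norm_le_pi_norm v i) 2
      _ = _ := by simp
  calc _ ≤ (u ⬝ᵥ (M *ᵥ u)) / Fintype.card ι * (Fintype.card ι * ‖v‖ ^ 2) := by gcongr
    _ = (u ⬝ᵥ (M *ᵥ u)) * ‖v‖ ^ 2 := by field_simp
    _ ≤ _ := hle'

lemma sq_dotProduct_le {ι : Type*} [Fintype ι] (v w : ι → ℝ) :
    (v ⬝ᵥ w) ^ 2 ≤ (v ⬝ᵥ v) * (w ⬝ᵥ w) := by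
  simpa [dotProduct, sq] using Finset.sum_mul_sq_le_sq_mul_sq Finset.univ v w

lemma dotProduct_self_nonneg_real {ι : Type*} [Fintype ι] (v : ι → ℝ) : 0 ≤ v ⬝ᵥ v :=
  Finset.sum_nonneg fun i _ => mul_self_nonneg (v i)

lemma mulVec_dotProduct_self_le {ι : Type*} [Fintype ι] (B : Matrix ι ι ℝ) (v : ι → ℝ) :
    (B *ᵥ v) ⬝ᵥ (B *ᵥ v) ≤ (∑ i, B i ⬝ᵥ B i) * (v ⬝ᵥ v) := by
  rw [Finset.sum_mul]
  refine Finset.sum_le_sum fun i _ => ?_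
  rw [← sq]
  exact sq_dotProduct_le (B i) v

lemma norm_le_sqrt_dotProduct_self {ι : Type*} [Fintype ι] (v : ι → ℝ) :
    ‖v‖ ≤ √(v ⬝ᵥ v) := by
  refine (pi_norm_le_iff_of_nonneg (Real.sqrt_nonneg _)).mpr fun i => ?_
  rw [Real.norm_eq_abs]
  refine Real.abs_le_sqrt ?_
  rw [sq]
  exact Finset.single_le_sum (f := fun i => v i * v i)
    (fun j _ => mul_self_nonneg (v j)) (Finset.mem_univ i)

lemma hasDerivAt_dotProduct_self {ι : Type*} [Fintype ι] {f : ℝ → ι → ℝ} {f' : ι → ℝ} {t : ℝ}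
    (hf : HasDerivAt f f' t) :
    HasDerivAt (fun s => f s ⬝ᵥ f s) (2 * (f t ⬝ᵥ f')) t := by
  have h := HasDerivAt.fun_sum (u := Finset.univ) fun i _ =>
    (hasDerivAt_pi.mp hf i).mul (hasDerivAt_pi.mp hf i)
  refine h.congr_deriv ?_
  rw [dotProduct, Finset.mul_sum]
  exact Finset.sum_congr rfl fun i _ => by ring

lemma hasDerivAt_const_dotProduct {ι : Type*} [Fintype ι] (a : ι → ℝ) {f : ℝ → ι → ℝ}
    {f' : ι → ℝ} {t : ℝ} (hf : HasDerivAt f f' t) :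
    HasDerivAt (fun s => a ⬝ᵥ f s) (a ⬝ᵥ f') t :=
  HasDerivAt.fun_sum fun i _ => (hasDerivAt_pi.mp hf i).const_mul (a i)

lemma le_mul_exp_of_hasDerivAt_le {U U' : ℝ → ℝ} {a : ℝ}
    (hU : ∀ t, 0 ≤ t → HasDerivAt U (U' t) t) (hle : ∀ t, 0 ≤ t → U' t ≤ -a * U t)
    {t : ℝ} (ht : 0 ≤ t) : U t ≤ U 0 * Real.exp (-a * t) := by
  have hd : ∀ s, 0 ≤ s → HasDerivAt (fun s => U s * Real.exp (a * s))
      ((U' s + a * U s) * Real.exp (a * s)) s := fun s hs => by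
    have := (hU s hs).mul (((hasDerivAt_id s).const_mul a).exp)
    refine this.congr_deriv ?_
    simp only [id]
    ring
  have hanti : AntitoneOn (fun s => U s * Real.exp (a * s)) (Set.Ici 0) := by
    refine antitoneOn_of_hasDerivWithinAt_nonpos (convex_Ici 0)
      (fun s hs => (hd s hs).continuousAt.continuousWithinAt)
      (fun s hs => (hd s (interior_subset hs)).hasDerivWithinAt) fun s hs => ?_
    have := hle s (interior_subset hs)
    exact mul_nonpos_of_nonpos_of_nonneg (by linarith) (Real.exp_pos _).le
  have h := hanti Set.self_mem_Ici ht ht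
  simp only [mul_zero, Real.exp_zero, mul_one] at h
  rw [neg_mul, Real.exp_neg, ← div_eq_mul_inv, le_div_iff₀ (Real.exp_pos _)]
  exact h

section graph

variable {V : Type*} [Fintype V] [DecidableEq V] (G : SimpleGraph V) [DecidableRel G.Adj]

lemma two_mul_dotProduct_degree_add_adjMatrix {s : ℝ} (hs : s ^ 2 = 1) (v : V → ℝ) :
    2 * (v ⬝ᵥ ((diagonal (fun i => (G.degree i : ℝ)) + s • G.adjMatrix ℝ) *ᵥ v)) =
      ∑ i, ∑ j, if G.Adj i j then (v i + s * v j) ^ 2 else 0 := by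
  have hdeg : ∀ i, (G.degree i : ℝ) = ∑ j, if G.Adj i j then 1 else 0 := fun i => by
    rw [Finset.sum_boole, ← G.neighborFinset_eq_filter, G.card_neighborFinset_eq_degree]
  have hlhs : v ⬝ᵥ ((diagonal (fun i => (G.degree i : ℝ)) + s • G.adjMatrix ℝ) *ᵥ v) =
      ∑ i, ∑ j, if G.Adj i j then v i ^ 2 + s * (v i * v j) else 0 := by
    refine Finset.sum_congr rfl fun i _ => ?_
    rw [add_mulVec, Pi.add_apply, mulVec_diagonal, hdeg, smul_mulVec, Pi.smul_apply, mulVec,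
      dotProduct, smul_eq_mul, Finset.mul_sum, Finset.sum_mul, ← Finset.sum_add_distrib,
      Finset.mul_sum]
    refine Finset.sum_congr rfl fun j _ => ?_
    by_cases h : G.Adj i j <;> simp [h]
    ring
  have hswap : (∑ i, ∑ j, if G.Adj i j then v i ^ 2 + s * (v i * v j) else 0) =
      ∑ i, ∑ j, if G.Adj i j then v j ^ 2 + s * (v i * v j) else 0 := by
    rw [Finset.sum_comm]
    refine Finset.sum_congr rfl fun i _ => Finset.sum_congr rfl fun j _ => ?_
    simp only [G.adj_comm j i, mul_comm (v j)]
  rw [two_mul, hlhs]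
  nth_rewrite 2 [hswap]
  simp only [← Finset.sum_add_distrib]
  refine Finset.sum_congr rfl fun i _ => Finset.sum_congr rfl fun j _ => ?_
  split_ifs
  · linear_combination (-(v j) ^ 2) * hs
  · simp

lemma dotProduct_degree_add_adjMatrix_nonneg {s : ℝ} (hs : s ^ 2 = 1) (v : V → ℝ) :
    0 ≤ v ⬝ᵥ ((diagonal (fun i => (G.degree i : ℝ)) + s • G.adjMatrix ℝ) *ᵥ v) := by
  have h : 0 ≤ ∑ i, ∑ j, if G.Adj i j then (v i + s * v j) ^ 2 else 0 :=
    Finset.sum_nonneg fun i _ => Finset.sum_nonneg fun j _ => by split_ifs <;> positivity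
  linarith [two_mul_dotProduct_degree_add_adjMatrix G hs v]

lemma eq_neg_mul_of_dotProduct_degree_add_adjMatrix_eq_zero {s : ℝ} (hs : s ^ 2 = 1) {v : V → ℝ}
    (hv : v ⬝ᵥ ((diagonal (fun i => (G.degree i : ℝ)) + s • G.adjMatrix ℝ) *ᵥ v) = 0)
    {i j : V} (hij : G.Adj i j) : v i = -s * v j := by
  have h := two_mul_dotProduct_degree_add_adjMatrix G hs v
  rw [hv, mul_zero] at h
  have hnn : ∀ i j, 0 ≤ if G.Adj i j then (v i + s * v j) ^ 2 else 0 := fun i j => by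
    split_ifs <;> positivity
  have hi := (Finset.sum_eq_zero_iff_of_nonneg
    fun i _ => Finset.sum_nonneg fun j _ => hnn i j).mp h.symm i (Finset.mem_univ i)
  have hj := (Finset.sum_eq_zero_iff_of_nonneg fun j _ => hnn i j).mp hi j (Finset.mem_univ j)
  rw [if_pos hij] at hj
  linarith [pow_eq_zero_iff (two_ne_zero) |>.mp hj]

end graph

lemma SimpleGraph.Connected.apply_eq_of_adj {V α : Type*} {G : SimpleGraph V} (hG : G.Connected)
    {f : V → α} (hf : ∀ i j, G.Adj i j → f i = f j) (i j : V) : f i = f j := by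
  obtain ⟨p⟩ := hG.preconnected i j
  induction p with
  | nil => rfl
  | cons h _ ih => exact (hf _ _ h).trans ih

lemma signlessLaplacian_dotProduct_pos {n : ℕ} (G : SimpleGraph (Fin n)) [DecidableRel G.Adj]
    (hconn : G.Connected) (hnbip : ¬ IsBipartite G) (v : Fin n → ℝ) (hv : v ≠ 0) :
    0 < v ⬝ᵥ ((G.adjMatrix ℝ + diagonal (fun i => (G.degree i : ℝ))) *ᵥ v) := by
  have hs : (1 : ℝ) ^ 2 = 1 := one_pow 2
  have hM : G.adjMatrix ℝ + diagonal (fun i => (G.degree i : ℝ)) =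
      diagonal (fun i => (G.degree i : ℝ)) + (1 : ℝ) • G.adjMatrix ℝ := by
    rw [one_smul, add_comm]
  rw [hM]
  refine lt_of_le_of_ne (dotProduct_degree_add_adjMatrix_nonneg G hs v) fun h0 => hnbip ?_
  have hadj : ∀ i j, G.Adj i j → v i = -v j := fun i j hij => by
    simpa using eq_neg_mul_of_dotProduct_degree_add_adjMatrix_eq_zero G hs h0.symm hij
  have habs := hconn.apply_eq_of_adj (f := fun i => |v i|) fun i j hij => by
    rw [hadj i j hij, abs_neg]
  obtain ⟨k, hk⟩ := Function.ne_iff.mp hv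
  have hne : ∀ i, v i ≠ 0 := fun i hi => by
    have := habs k i
    simp only [hi, abs_zero, abs_eq_zero] at this
    exact hk this
  refine ⟨{i | 0 < v i}, {i | v i < 0}, ?_, ?_, fun i j hij => ?_⟩
  · exact Set.disjoint_left.mpr fun i (hi : 0 < v i) (hi' : v i < 0) => lt_asymm hi hi'
  · exact Set.eq_univ_of_forall fun i => (hne i).lt_or_gt.symm
  · have := hadj i j hij
    rcases (hne i).lt_or_gt with h | h
    · exact Or.inr ⟨h, show 0 < v j by linarith⟩
    · exact Or.inl ⟨h, show v j < 0 by linarith⟩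

lemma laplacian_add_ones_dotProduct_pos {V : Type*} [Fintype V] [DecidableEq V]
    (G : SimpleGraph V) [DecidableRel G.Adj] (hconn : G.Connected) (v : V → ℝ) (hv : v ≠ 0) :
    0 < v ⬝ᵥ ((diagonal (fun i => (G.degree i : ℝ)) - G.adjMatrix ℝ + of fun _ _ => 1) *ᵥ v) := by
  have hs : (-1 : ℝ) ^ 2 = 1 := by norm_num
  have hJ : v ⬝ᵥ ((of fun _ _ => (1 : ℝ)) *ᵥ v) = (∑ i, v i) ^ 2 := by
    simp [dotProduct, mulVec, sq, Finset.sum_mul]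
  have hM : diagonal (fun i => (G.degree i : ℝ)) - G.adjMatrix ℝ =
      diagonal (fun i => (G.degree i : ℝ)) + (-1 : ℝ) • G.adjMatrix ℝ := by
    rw [neg_one_smul, sub_eq_add_neg]
  have hL := dotProduct_degree_add_adjMatrix_nonneg G hs v
  rw [add_mulVec, dotProduct_add, hJ, hM]
  refine lt_of_le_of_ne (by positivity) fun h0 => hv ?_
  have hL0 : v ⬝ᵥ ((diagonal (fun i => (G.degree i : ℝ)) + (-1 : ℝ) • G.adjMatrix ℝ) *ᵥ v) = 0 := by
    linarith [sq_nonneg (∑ i, v i)]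
  have hS : ∑ i, v i = 0 := by
    rw [hL0, zero_add] at h0
    exact pow_eq_zero_iff two_ne_zero |>.mp h0.symm
  have hconst := hconn.apply_eq_of_adj (f := v) fun i j hij => by
    simpa using eq_neg_mul_of_dotProduct_degree_add_adjMatrix_eq_zero G hs hL0 hij
  funext i
  have : Nonempty V := ⟨i⟩
  rw [Finset.sum_congr rfl fun j _ => hconst j i, Finset.sum_const, Finset.card_univ,
    nsmul_eq_mul] at hS
  exact (mul_eq_zero.mp hS).resolve_left (by exact_mod_cast Fintype.card_ne_zero)

lemma laplacian_mulVec_const {V : Type*} [Fintype V] [DecidableEq V] (G : SimpleGraph V)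
    [DecidableRel G.Adj] (c : ℝ) :
    (diagonal (fun i => (G.degree i : ℝ)) - G.adjMatrix ℝ) *ᵥ (fun _ => c) = 0 := by
  funext i
  simp [sub_mulVec, mulVec_diagonal, SimpleGraph.adjMatrix_mulVec_apply]

lemma one_dotProduct_laplacian_mulVec {V : Type*} [Fintype V] [DecidableEq V] (G : SimpleGraph V)
    [DecidableRel G.Adj] (v : V → ℝ) :
    1 ⬝ᵥ ((diagonal (fun i => (G.degree i : ℝ)) - G.adjMatrix ℝ) *ᵥ v) = 0 := by
  rw [dotProduct_mulVec, ← mulVec_transpose, transpose_sub, diagonal_transpose,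
    SimpleGraph.transpose_adjMatrix]
  exact (congrArg (· ⬝ᵥ v) (laplacian_mulVec_const G 1)).trans (zero_dotProduct v)

/-- A Lyapunov estimate for a cascade `ė = -Q e`, `ż = -L z - B e` in which `Q` is positive
definite, `L` is positive definite up to the all-ones matrix, and the sum of the entries of `z`
is controlled by `e`. -/
lemma exists_exp_bound_of_cascade {ι : Type*} [Fintype ι] {Q L B : Matrix ι ι ℝ}
    (hQ : ∀ v : ι → ℝ, v ≠ 0 → 0 < v ⬝ᵥ (Q *ᵥ v))
    (hL : ∀ v : ι → ℝ, v ≠ 0 → 0 < v ⬝ᵥ ((L + of fun _ _ => 1) *ᵥ v))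
    {e z : ℝ → ι → ℝ} (he : ∀ t, 0 ≤ t → HasDerivAt e (-(Q *ᵥ e t)) t)
    (hz : ∀ t, 0 ≤ t → HasDerivAt z (-(L *ᵥ z t) - B *ᵥ e t) t)
    {g : ι → ℝ} (hg : ∀ t, 0 ≤ t → 1 ⬝ᵥ z t = g ⬝ᵥ e t) :
    ∃ C > (0 : ℝ), ∃ α > (0 : ℝ), ∀ t : ℝ, 0 ≤ t →
      ‖e t‖ ≤ C * Real.exp (-α * t) ∧ ‖z t‖ ≤ C * Real.exp (-α * t) := by
  obtain ⟨r, hr, hQr⟩ := exists_mul_dotProduct_self_le Q hQ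
  obtain ⟨m, hm, hLm⟩ := exists_mul_dotProduct_self_le _ hL
  set K : ℝ := 2 * (g ⬝ᵥ g) + (∑ i, B i ⬝ᵥ B i) / m with hK
  have hK0 : 0 ≤ K := by
    have := dotProduct_self_nonneg_real g
    have : 0 ≤ ∑ i, B i ⬝ᵥ B i := Finset.sum_nonneg fun i _ => dotProduct_self_nonneg_real _
    positivity
  set b : ℝ := K / r + 1 with hb
  have hb1 : 1 ≤ b := by
    have : 0 ≤ K / r := by positivity
    linarith
  have hbr : K ≤ r * b := by
    have : r * b = K + r := by rw [hb]; field_simp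
    linarith
  set a : ℝ := min r m
  have ha0 : 0 < a := lt_min hr hm
  set U : ℝ → ℝ := fun t => z t ⬝ᵥ z t + b * (e t ⬝ᵥ e t) with hU
  have hUd : ∀ t, 0 ≤ t → HasDerivAt U (2 * (z t ⬝ᵥ (-(L *ᵥ z t) - B *ᵥ e t)) +
      b * (2 * (e t ⬝ᵥ (-(Q *ᵥ e t))))) t := fun t ht =>
    (hasDerivAt_dotProduct_self (hz t ht)).add
      ((hasDerivAt_dotProduct_self (he t ht)).const_mul b)
  have hUle : ∀ t, 0 ≤ t → 2 * (z t ⬝ᵥ (-(L *ᵥ z t) - B *ᵥ e t)) +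
      b * (2 * (e t ⬝ᵥ (-(Q *ᵥ e t)))) ≤ -a * U t := fun t ht => by
    have hJ : z t ⬝ᵥ ((of fun _ _ => (1 : ℝ)) *ᵥ z t) = (1 ⬝ᵥ z t) ^ 2 := by
      simp [dotProduct, mulVec, sq, Finset.sum_mul]
    have h1 := hLm (z t)
    rw [add_mulVec, dotProduct_add, hJ, hg t ht] at h1
    have h2 := sq_dotProduct_le g (e t)
    have h3 := mulVec_dotProduct_self_le B (e t)
    have h4 := hQr (e t)
    have hz0 := dotProduct_self_nonneg_real (z t)
    have he0 := dotProduct_self_nonneg_real (e t)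
    have h5 : 0 ≤ m * (z t ⬝ᵥ z t) + 2 * (z t ⬝ᵥ (B *ᵥ e t)) +
        (B *ᵥ e t) ⬝ᵥ (B *ᵥ e t) / m := by
      have := dotProduct_self_nonneg_real (m • z t + B *ᵥ e t)
      simp only [add_dotProduct, dotProduct_add, smul_dotProduct, dotProduct_smul,
        smul_eq_mul] at this
      rw [dotProduct_comm (B *ᵥ e t) (z t)] at this
      have h := div_nonneg this hm.le
      have heq : (m * (m * (z t ⬝ᵥ z t) + z t ⬝ᵥ (B *ᵥ e t)) +
          (m * (z t ⬝ᵥ (B *ᵥ e t)) + (B *ᵥ e t) ⬝ᵥ (B *ᵥ e t))) / m =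
          m * (z t ⬝ᵥ z t) + 2 * (z t ⬝ᵥ (B *ᵥ e t)) + (B *ᵥ e t) ⬝ᵥ (B *ᵥ e t) / m := by
        field_simp
        ring
      linarith
    have h6 : (B *ᵥ e t) ⬝ᵥ (B *ᵥ e t) / m ≤ (∑ i, B i ⬝ᵥ B i) / m * (e t ⬝ᵥ e t) := by
      rw [div_mul_eq_mul_div]
      gcongr
    have h7 : K * (e t ⬝ᵥ e t) ≤ r * b * (e t ⬝ᵥ e t) := by gcongr
    have h8 : a * (z t ⬝ᵥ z t) ≤ m * (z t ⬝ᵥ z t) := by gcongr; exact min_le_right _ _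
    have h9 : a * (b * (e t ⬝ᵥ e t)) ≤ r * (b * (e t ⬝ᵥ e t)) := by
      gcongr
      exact min_le_left _ _
    have h10 : b * (r * (e t ⬝ᵥ e t)) ≤ b * (e t ⬝ᵥ (Q *ᵥ e t)) := by gcongr
    simp only [hU, dotProduct_sub, dotProduct_neg]
    have hKe : K * (e t ⬝ᵥ e t) = 2 * ((g ⬝ᵥ g) * (e t ⬝ᵥ e t)) +
      (∑ i, B i ⬝ᵥ B i) / m * (e t ⬝ᵥ e t) := by rw [hK]; ring
    linarith
  have hU0 : 0 ≤ U 0 := by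
    have := dotProduct_self_nonneg_real (z 0)
    have := dotProduct_self_nonneg_real (e 0)
    positivity
  have hexp : ∀ t, 0 ≤ t → √(U t) ≤ (√(U 0) + 1) * Real.exp (-(a / 2) * t) := fun t ht => by
    have hsq : Real.exp (-a * t) = Real.exp (-(a / 2) * t) ^ 2 := by
      rw [← Real.exp_nat_mul]
      congr 1
      push_cast
      ring
    calc √(U t) ≤ √(U 0 * Real.exp (-a * t)) :=
          Real.sqrt_le_sqrt (le_mul_exp_of_hasDerivAt_le hUd hUle ht)
      _ = √(U 0) * Real.exp (-(a / 2) * t) := by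
          rw [Real.sqrt_mul hU0, hsq, Real.sqrt_sq (Real.exp_pos _).le]
      _ ≤ _ := by gcongr; linarith
  refine ⟨√(U 0) + 1, by positivity, a / 2, by positivity, fun t ht => ?_⟩
  have hz0 := dotProduct_self_nonneg_real (z t)
  have he0 := dotProduct_self_nonneg_real (e t)
  have hbe : e t ⬝ᵥ e t ≤ b * (e t ⬝ᵥ e t) := le_mul_of_one_le_left he0 hb1
  exact ⟨((norm_le_sqrt_dotProduct_self _).trans
      (Real.sqrt_le_sqrt (by simp only [hU]; linarith))).trans (hexp t ht),
    ((norm_le_sqrt_dotProduct_self _).trans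
      (Real.sqrt_le_sqrt (by simp only [hU]; linarith))).trans (hexp t ht)⟩

/-- if `G` is not bipartite and `(e, x)` solves
`ė = -(A + D) e`, `ẋ = -L x - D e`, then `e` converges exponentially to `0` and `x`
converges exponentially to a consensus vector `c • 𝟙`; moreover if `e 0 = -w` then
`c = (1/n) 𝟙ᵀ D (A + D)⁻¹ w + (1/n) 𝟙ᵀ x(0)`. -/
theorem stmt10 {n : ℕ} (hn : 2 ≤ n) (G : SimpleGraph (Fin n)) [DecidableRel G.Adj]
    (hconn : G.Connected) (hnbip : ¬ IsBipartite G)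
    (Dm Q L : Matrix (Fin n) (Fin n) ℝ)
    (hD : Dm = Matrix.diagonal (fun i => (G.degree i : ℝ)))
    (hQ : Q = G.adjMatrix ℝ + Dm) (hL : L = Dm - G.adjMatrix ℝ)
    (e x : ℝ → (Fin n → ℝ))
    (he : ∀ t : ℝ, 0 ≤ t → HasDerivAt e (-(Q *ᵥ e t)) t)
    (hx : ∀ t : ℝ, 0 ≤ t → HasDerivAt x (-(L *ᵥ x t) - Dm *ᵥ e t) t) :
    ∃ c : ℝ,
      (∃ C > (0 : ℝ), ∃ α > (0 : ℝ), ∀ t : ℝ, 0 ≤ t →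
        ‖e t‖ ≤ C * Real.exp (-α * t) ∧
        ‖x t - (fun _ : Fin n => c)‖ ≤ C * Real.exp (-α * t)) ∧
      (∀ w : Fin n → ℝ, e 0 = -w →
        c = (1 / (n : ℝ)) * (∑ i : Fin n, (Dm *ᵥ (Q⁻¹ *ᵥ w)) i) +
            (1 / (n : ℝ)) * (∑ i : Fin n, x 0 i)) := by
  have hn0 : (n : ℝ) ≠ 0 := by
    norm_cast
    omega
  subst hD
  have hQpos : ∀ v : Fin n → ℝ, v ≠ 0 → 0 < v ⬝ᵥ (Q *ᵥ v) := by
    rw [hQ]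
    exact signlessLaplacian_dotProduct_pos G hconn hnbip
  have hdet : IsUnit Q.det := by
    refine isUnit_iff_ne_zero.mpr fun h => ?_
    obtain ⟨v, hv, hv0⟩ := exists_mulVec_eq_zero_iff.mpr h
    have := hQpos v hv
    simp [hv0] at this
  set Dm : Matrix (Fin n) (Fin n) ℝ := diagonal (fun i => (G.degree i : ℝ))
  set g : Fin n → ℝ := 1 ᵥ* (Dm * Q⁻¹) with hgdef
  have hg : ∀ v, g ⬝ᵥ v = ∑ i, (Dm *ᵥ (Q⁻¹ *ᵥ v)) i := fun v => by
    rw [hgdef, ← dotProduct_mulVec, one_dotProduct, mulVec_mulVec]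
  have hgQ : ∀ v, g ⬝ᵥ (Q *ᵥ v) = 1 ⬝ᵥ (Dm *ᵥ v) := fun v => by
    rw [hg, mulVec_mulVec v Q⁻¹, nonsing_inv_mul _ hdet, one_mulVec, one_dotProduct]
  have hcons : ∀ t, 0 ≤ t → 1 ⬝ᵥ x t - g ⬝ᵥ e t = 1 ⬝ᵥ x 0 - g ⬝ᵥ e 0 := fun t ht => by
    have hd : ∀ s, 0 ≤ s → HasDerivAt (fun s => 1 ⬝ᵥ x s - g ⬝ᵥ e s) 0 s := fun s hs => by
      refine ((hasDerivAt_const_dotProduct 1 (hx s hs)).sub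
        (hasDerivAt_const_dotProduct g (he s hs))).congr_deriv ?_
      rw [dotProduct_sub, dotProduct_neg, dotProduct_neg, hgQ, hL,
        one_dotProduct_laplacian_mulVec]
      ring
    exact constant_of_has_deriv_right_zero (a := 0) (b := t)
      (fun s hs => (hd s hs.1).continuousAt.continuousWithinAt)
      (fun s hs => (hd s hs.1).hasDerivWithinAt) t ⟨ht, le_rfl⟩
  set c : ℝ := (1 / (n : ℝ)) * (1 ⬝ᵥ x 0 - g ⬝ᵥ e 0) with hc
  refine ⟨c, ?_, fun w hw => ?_⟩
  · refine exists_exp_bound_of_cascade (L := L) (B := Dm) (g := g) hQpos ?_ he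
      (z := fun t => x t - fun _ => c) (fun t ht => ?_) fun t ht => ?_
    · rw [hL]
      exact laplacian_add_ones_dotProduct_pos G hconn
    · refine ((hx t ht).sub_const _).congr_deriv ?_
      rw [mulVec_sub, hL, laplacian_mulVec_const, sub_zero]
    · have hsum : (1 : Fin n → ℝ) ⬝ᵥ (fun _ => c) = n * c := by
        simp [dotProduct]
      have hnc : n * c = 1 ⬝ᵥ x 0 - g ⬝ᵥ e 0 := by rw [hc]; field_simp
      rw [dotProduct_sub, hsum, hnc, ← hcons t ht]
      ring
  · rw [hc, hw, dotProduct_neg, hg, one_dotProduct]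
    ring
end

section
/- Suppose G is bipartite and let k = ⌊(n−1)/2⌋. If w ∈ 𝒲_k solves the measurement system for data z lying in the column span of 𝓑, then w is the unique solution of the measurement system for z in 𝒲_k. -/
open Matrix

/-- The number of nonzero entries of a vector (its `ℓ₀`-"norm"). -/
noncomputable def zeroNorm {n : ℕ} (w : Fin n → ℝ) : ℕ := Set.ncard {i | w i ≠ 0}

theorem Bplus_mulVec {n : ℕ} (G : SimpleGraph (Fin n)) (hd : G.edgeSet → Fin n)
    (x : Fin n → ℝ) (e : G.edgeSet) : (Bplus G hd *ᵥ x) e = x (hd e) := by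
  simp [Bplus, Matrix.mulVec, dotProduct]

theorem Bminus_mulVec {n : ℕ} (G : SimpleGraph (Fin n)) (tl : G.edgeSet → Fin n)
    (x : Fin n → ℝ) (e : G.edgeSet) : (Bminus G tl *ᵥ x) e = -x (tl e) := by
  simp [Bminus, Matrix.mulVec, dotProduct]

/-- Adding the two measurements of an edge eliminates the unknown `x̄`. -/
theorem Solves.add_eq {n : ℕ} {G : SimpleGraph (Fin n)} {hd tl : G.edgeSet → Fin n}
    {ζ η : G.edgeSet → ℝ} {w : Fin n → ℝ} (h : Solves G hd tl ζ η w) (e : G.edgeSet) :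
    w (hd e) + w (tl e) = ζ e + η e := by
  obtain ⟨x, rfl, rfl⟩ := h
  simp only [Pi.add_apply, Pi.sub_apply, Pi.neg_apply, Bplus_mulVec, Bminus_mulVec]
  ring

/-- Across an edge, the difference of two solutions changes sign. -/
theorem Solves.sub_eq_neg_sub {n : ℕ} {G : SimpleGraph (Fin n)} {hd tl : G.edgeSet → Fin n}
    (horient : IsOrientation G hd tl) {ζ η : G.edgeSet → ℝ} {w w' : Fin n → ℝ}
    (hw : Solves G hd tl ζ η w) (hw' : Solves G hd tl ζ η w') {u v : Fin n} (huv : G.Adj u v) :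
    w' v - w v = -(w' u - w u) := by
  let e : G.edgeSet := ⟨s(u, v), huv⟩
  have h := hw.add_eq e
  have h' := hw'.add_eq e
  have he : s(u, v) = s(hd e, tl e) := (horient e).2
  rcases Sym2.eq_iff.mp he with ⟨hu, hv⟩ | ⟨hu, hv⟩ <;> rw [← hu, ← hv] at h h' <;> linarith

/-- On a connected graph, two solutions that agree at one vertex agree everywhere. -/
theorem Solves.eq_of_apply_eq {n : ℕ} {G : SimpleGraph (Fin n)} (hconn : G.Connected)
    {hd tl : G.edgeSet → Fin n} (horient : IsOrientation G hd tl) {ζ η : G.edgeSet → ℝ}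
    {w w' : Fin n → ℝ} (hw : Solves G hd tl ζ η w) (hw' : Solves G hd tl ζ η w') {u : Fin n}
    (hu : w' u = w u) : w' = w := by
  funext v
  obtain ⟨p⟩ := hconn u v
  induction p with
  | nil => exact hu
  | cons hadj _ ih => exact ih (by linarith [hw.sub_eq_neg_sub horient hw' hadj])

/-- Two sparse vectors whose sparsities sum to less than `n` vanish at a common index. -/
theorem exists_eq_zero_of_zeroNorm_add_lt {n : ℕ} {w w' : Fin n → ℝ}
    (h : zeroNorm w + zeroNorm w' < n) : ∃ i, w i = 0 ∧ w' i = 0 := by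
  by_contra! hne
  have hcover : {i | w i ≠ 0} ∪ {i | w' i ≠ 0} = Set.univ := by
    ext i
    simpa [or_iff_not_imp_left] using hne i
  have hcard := Set.ncard_union_le {i | w i ≠ 0} {i | w' i ≠ 0}
  rw [hcover, Set.ncard_univ, Nat.card_fin] at hcard
  exact absurd h hcard.not_gt

/-- for bipartite `G` and `k = ⌊(n-1)/2⌋`, a solution `w ∈ 𝒲ₖ` of the
measurement system is the unique solution in `𝒲ₖ`. -/
theorem stmt11 {n : ℕ} (hn : 2 ≤ n) (G : SimpleGraph (Fin n)) (hconn : G.Connected)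
    (hbip : IsBipartite G)
    (hd tl : G.edgeSet → Fin n) (horient : IsOrientation G hd tl)
    (ζ η : G.edgeSet → ℝ) (w : Fin n → ℝ)
    (hwsp : zeroNorm w ≤ (n - 1) / 2) (hw : Solves G hd tl ζ η w) :
    ∀ w' : Fin n → ℝ, zeroNorm w' ≤ (n - 1) / 2 →
      Solves G hd tl ζ η w' → w' = w := by
  intro w' hwsp' hw'
  obtain ⟨i, hi, hi'⟩ := exists_eq_zero_of_zeroNorm_add_lt
    (show zeroNorm w + zeroNorm w' < n by omega)
  exact hw.eq_of_apply_eq hconn horient hw' (hi'.trans hi.symm)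
end

section
/- Suppose G is bipartite and let k = ⌊(n−1)/2⌋. If w, w' ∈ ℝ^n satisfy ‖w‖₀ ≤ k, ‖w'‖₀ ≤ k, and R w = R w', then w = w'. -/
open Matrix

/-- The signless edge–node incidence matrix of a simple graph `G`. -/
noncomputable def signlessInc (n : ℕ) (G : SimpleGraph (Fin n)) :
    Matrix G.edgeSet (Fin n) ℝ :=
  Matrix.of fun e i => if i ∈ (e : Sym2 (Fin n)) then (1 : ℝ) else 0

/-- The product `R w` has entry `w u + w v` at the edge `uv`. -/
theorem signlessInc_mulVec_apply {n : ℕ} {G : SimpleGraph (Fin n)} (w : Fin n → ℝ)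
    {u v : Fin n} (h : G.Adj u v) :
    (signlessInc n G *ᵥ w) ⟨s(u, v), h⟩ = w u + w v := by
  have hf : (Finset.univ.filter fun i => i = u ∨ i = v) = {u, v} := by
    ext i
    simp
  simp only [signlessInc, mulVec, dotProduct, of_apply, Sym2.mem_iff, ite_mul, one_mul, zero_mul]
  rw [← Finset.sum_filter, hf, Finset.sum_pair h.ne]

/-- Two vectors whose supports have total size less than `n` have a common zero. -/
theorem exists_common_zero {n : ℕ} (w w' : Fin n → ℝ) (h : zeroNorm w + zeroNorm w' < n) :
    ∃ i, w i = 0 ∧ w' i = 0 := by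
  by_contra! hne
  have hu : {i | w i ≠ 0} ∪ {i | w' i ≠ 0} = Set.univ :=
    Set.eq_univ_of_forall fun i => or_iff_not_imp_left.mpr fun hi => hne i (not_not.mp hi)
  have hle := Set.ncard_union_le {i | w i ≠ 0} {i | w' i ≠ 0}
  rw [hu, Set.ncard_univ, Nat.card_fin] at hle
  exact absurd h (not_lt.mpr hle)

/-- On a connected graph, vectors with the same image under the signless incidence matrix
coincide as soon as they agree at one vertex. -/
theorem eq_of_signlessInc_mulVec_eq {n : ℕ} {G : SimpleGraph (Fin n)} (hconn : G.Connected)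
    {w w' : Fin n → ℝ} (heq : signlessInc n G *ᵥ w = signlessInc n G *ᵥ w')
    {i : Fin n} (hi : w i = w' i) : w = w' := by
  have walk : ∀ {u v : Fin n}, G.Walk u v → w u = w' u → w v = w' v := by
    intro u v p
    induction p with
    | nil => exact id
    | @cons u x _ hadj _ ih =>
      intro hu
      have he := congrFun heq ⟨s(u, x), hadj⟩
      rw [signlessInc_mulVec_apply w hadj, signlessInc_mulVec_apply w' hadj] at he
      exact ih (by linarith)
  funext j
  obtain ⟨p⟩ := hconn.preconnected i j
  exact walk p hi

/-- for bipartite `G` and `k = ⌊(n-1)/2⌋`, any two `k`-sparse vectors with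
the same image under `R` coincide. -/
theorem stmt12 {n : ℕ} (hn : 2 ≤ n) (G : SimpleGraph (Fin n)) (hconn : G.Connected)
    (hbip : IsBipartite G) (w w' : Fin n → ℝ)
    (hw : zeroNorm w ≤ (n - 1) / 2) (hw' : zeroNorm w' ≤ (n - 1) / 2)
    (heq : signlessInc n G *ᵥ w = signlessInc n G *ᵥ w') :
    w = w' := by
  obtain ⟨i, hi, hi'⟩ := exists_common_zero w w' (by omega)
  exact eq_of_signlessInc_mulVec_eq hconn heq (hi.trans hi'.symm)
end

section
/- Suppose G is bipartite. If w ∈ 𝒲^h_{n−3} solves the measurement system for data z lying in the column span of 𝓑, then w is the unique solution of the measurement system for z in 𝒲_{n−3}. -/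
open Matrix

/-- Adding the two measurements of an edge gives the sum of `wbar` over its endpoints. -/
lemma Solves.add_apply {n : ℕ} {G : SimpleGraph (Fin n)} {hd tl : G.edgeSet → Fin n}
    {ζ η : G.edgeSet → ℝ} {wbar : Fin n → ℝ} (h : Solves G hd tl ζ η wbar) (e : G.edgeSet) :
    ζ e + η e = wbar (hd e) + wbar (tl e) := by
  obtain ⟨x, rfl, rfl⟩ := h
  have hp : (Bplus G hd *ᵥ wbar) e = wbar (hd e) := by
    simp [Bplus, Matrix.mulVec, dotProduct]
  have hm : (Bminus G tl *ᵥ wbar) e = -wbar (tl e) := by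
    simp [Bminus, Matrix.mulVec, dotProduct]
  simp only [Pi.add_apply, Pi.sub_apply, Pi.neg_apply, hp, hm]
  ring

/-- Two solutions for the same data differ by opposite amounts at adjacent vertices. -/
lemma Solves.sub_eq_neg_sub_of_adj {n : ℕ} {G : SimpleGraph (Fin n)}
    {hd tl : G.edgeSet → Fin n} (horient : IsOrientation G hd tl) {ζ η : G.edgeSet → ℝ}
    {w w' : Fin n → ℝ} (hw : Solves G hd tl ζ η w) (hw' : Solves G hd tl ζ η w')
    {u v : Fin n} (huv : G.Adj u v) : w' u - w u = -(w' v - w v) := by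
  let e : G.edgeSet := ⟨s(u, v), huv⟩
  have h := hw.add_apply e
  have h' := hw'.add_apply e
  have he : s(u, v) = s(hd e, tl e) := (horient e).2
  rcases Sym2.eq_iff.mp he with ⟨hu, hv⟩ | ⟨hu, hv⟩ <;> rw [hu, hv] <;> linarith

/-- On a connected graph, two solutions for the same data differ by a constant absolute value. -/
lemma Solves.abs_sub_eq {n : ℕ} {G : SimpleGraph (Fin n)} (hconn : G.Connected)
    {hd tl : G.edgeSet → Fin n} (horient : IsOrientation G hd tl) {ζ η : G.edgeSet → ℝ}
    {w w' : Fin n → ℝ} (hw : Solves G hd tl ζ η w) (hw' : Solves G hd tl ζ η w')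
    (u v : Fin n) : |w' u - w u| = |w' v - w v| := by
  obtain ⟨p⟩ := hconn.preconnected u v
  induction p with
  | nil => rfl
  | cons hadj _ ih => rw [← ih, hw.sub_eq_neg_sub_of_adj horient hw' hadj, abs_neg]

lemma eq_zero_of_zeroNorm_eq_zero {n : ℕ} {w : Fin n → ℝ} (h : zeroNorm w = 0) : w = 0 := by
  have h0 : {i | w i ≠ 0} = ∅ := (Set.ncard_eq_zero (Set.toFinite _)).mp h
  funext i
  by_contra hi
  exact (Set.eq_empty_iff_forall_notMem.mp h0 i) hi

lemma zeroNorm_add_ncard_zeros {n : ℕ} (w : Fin n → ℝ) :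
    zeroNorm w + Set.ncard {i | w i = 0} = n := by
  have h := Set.ncard_add_ncard_compl {i | w i ≠ 0}
  have hc : {i | w i ≠ 0}ᶜ = {i | w i = 0} := by ext; simp
  rw [hc, Nat.card_fin] at h
  exact h

/-- A vector at constant nonzero distance, entrywise, from a vector with pairwise distinct
nonzero entries has at most two zeros. -/
lemma ncard_zeros_le_two {n : ℕ} {w w' : Fin n → ℝ} {c : ℝ} (hc : c ≠ 0)
    (hwhet : ∀ i j : Fin n, i ≠ j → w i ≠ 0 → w j ≠ 0 → w i ≠ w j)
    (h : ∀ i, |w' i - w i| = c) : Set.ncard {i | w' i = 0} ≤ 2 := by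
  have hz : ∀ i ∈ {i | w' i = 0}, |w i| = c := by
    intro i (hi : w' i = 0)
    simpa [hi] using h i
  have hne : ∀ i ∈ {i | w' i = 0}, w i ≠ 0 := by
    intro i hi h0
    exact hc (by simpa [h0] using (hz i hi).symm)
  calc Set.ncard {i | w' i = 0} ≤ Set.ncard ({c, -c} : Set ℝ) := by
        refine Set.ncard_le_ncard_of_injOn w (fun i hi => ?_) (fun i hi j hj hij => ?_)
          (Set.toFinite _)
        · exact eq_or_eq_neg_of_abs_eq (hz i hi)
        · by_contra hne'
          exact hwhet i j hne' (hne i hi) (hne j hj) hij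
    _ ≤ 2 := (Set.ncard_insert_le _ _).trans (by rw [Set.ncard_singleton])

/-- for bipartite `G`, a solution `w ∈ 𝒲ʰ_{n-3}` (at most `n-3` nonzero
entries, which are pairwise distinct) of the measurement system is the unique solution
in `𝒲_{n-3}`. -/
theorem stmt13 {n : ℕ} (hn : 2 ≤ n) (G : SimpleGraph (Fin n)) (hconn : G.Connected)
    (hbip : IsBipartite G)
    (hd tl : G.edgeSet → Fin n) (horient : IsOrientation G hd tl)
    (ζ η : G.edgeSet → ℝ) (w : Fin n → ℝ)
    (hwsp : zeroNorm w ≤ n - 3)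
    (hwhet : ∀ i j : Fin n, i ≠ j → w i ≠ 0 → w j ≠ 0 → w i ≠ w j)
    (hw : Solves G hd tl ζ η w) :
    ∀ w' : Fin n → ℝ, zeroNorm w' ≤ n - 3 → Solves G hd tl ζ η w' → w' = w := by
  intro w' hwsp' hw'
  rcases Nat.lt_or_ge n 3 with hlt | hge
  · rw [eq_zero_of_zeroNorm_eq_zero (by omega : zeroNorm w = 0),
      eq_zero_of_zeroNorm_eq_zero (by omega : zeroNorm w' = 0)]
  · by_contra hne
    obtain ⟨k, hk⟩ := Function.ne_iff.mp hne
    have hzeros := ncard_zeros_le_two (abs_ne_zero.mpr (sub_ne_zero.mpr hk)) hwhet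
      (fun i => hw.abs_sub_eq hconn horient hw' i k)
    have := zeroNorm_add_ncard_zeros w'
    omega
end

section
/- Suppose G is bipartite and the bias vector satisfies w ∈ 𝒲^a_{n−2}. Let i, j ∈ V be distinct, let P = (k_0, …, k_d) be a path from i to j, and let I_{ij} = Σ_{ℓ=1}^{d} (−1)^{d−ℓ} (z_{k_{ℓ−1} k_ℓ} + z_{k_ℓ k_{ℓ−1}}), where z_{rs} = x_s − x_r + w_r for adjacent r, s. Then: (i) I_{ij} = 0 if and only if w_i = w_j = 0; and (ii) if w_i = 0 then I_{ij} = w_j. -/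
/-- An alternating sum of sums of consecutive terms telescopes. -/
theorem sum_neg_one_pow_mul_add_consecutive {R : Type*} [CommRing R] (a : ℕ → R) (d : ℕ) :
    ∑ ℓ ∈ Finset.Icc 1 d, (-1 : R) ^ (d - ℓ) * (a (ℓ - 1) + a ℓ) = a d - (-1) ^ d * a 0 := by
  induction d with
  | zero => simp
  | succ d ih =>
    have hstep : ∑ ℓ ∈ Finset.Icc 1 d, (-1 : R) ^ (d + 1 - ℓ) * (a (ℓ - 1) + a ℓ) =
        -∑ ℓ ∈ Finset.Icc 1 d, (-1 : R) ^ (d - ℓ) * (a (ℓ - 1) + a ℓ) := by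
      rw [← Finset.sum_neg_distrib]
      refine Finset.sum_congr rfl fun ℓ hℓ => ?_
      rw [Nat.succ_sub (Finset.mem_Icc.mp hℓ).2, pow_succ]
      ring
    rw [Finset.sum_Icc_succ_top (by omega), hstep, ih]
    simp only [Nat.sub_self, pow_zero, Nat.add_sub_cancel, pow_succ]
    ring

/-- for a bipartite graph with bias vector `w ∈ 𝒲ᵃ_{n-2}`, the indicator
`I = Σ_{ℓ=1}^{d} (-1)^{d-ℓ} (z (k (ℓ-1)) (k ℓ) + z (k ℓ) (k (ℓ-1)))` along a path from
`i = k 0` to `j = k d` satisfies: (i) `I = 0` iff `w i = w j = 0`; (ii) if `w i = 0`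
then `I = w j`. -/
theorem stmt16 {n : ℕ} (hn : 2 ≤ n) (G : SimpleGraph (Fin n)) (hconn : G.Connected)
    (hbip : IsBipartite G)
    (x w : Fin n → ℝ)
    (hwsp : zeroNorm w ≤ n - 2)
    (hwhet : ∀ i j : Fin n, i ≠ j → w i ≠ 0 → w j ≠ 0 → |w i| ≠ |w j|)
    (z : Fin n → Fin n → ℝ)
    (hz : ∀ r s : Fin n, G.Adj r s → z r s = x s - x r + w r)
    (i j : Fin n) (hij : i ≠ j)
    (d : ℕ) (hd : 1 ≤ d) (k : ℕ → Fin n) (hk0 : k 0 = i) (hkd : k d = j)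
    (hpath : ∀ ℓ < d, G.Adj (k ℓ) (k (ℓ + 1)))
    (I : ℝ)
    (hI : I = ∑ ℓ ∈ Finset.Icc 1 d,
        (-1 : ℝ) ^ (d - ℓ) * (z (k (ℓ - 1)) (k ℓ) + z (k ℓ) (k (ℓ - 1)))) :
    (I = 0 ↔ w i = 0 ∧ w j = 0) ∧ (w i = 0 → I = w j) := by
  have hI' : I = w j - (-1) ^ d * w i := by
    rw [hI, ← hk0, ← hkd, ← sum_neg_one_pow_mul_add_consecutive (fun ℓ => w (k ℓ)) d]
    refine Finset.sum_congr rfl fun ℓ hℓ => ?_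
    obtain ⟨h1, h2⟩ := Finset.mem_Icc.mp hℓ
    have hadj := hpath (ℓ - 1) (by omega)
    rw [Nat.sub_add_cancel h1] at hadj
    rw [hz _ _ hadj, hz _ _ hadj.symm]
    ring
  refine ⟨⟨fun h0 => ?_, fun ⟨hi, hj⟩ => by simp [hI', hi, hj]⟩, fun hi => by simp [hI', hi]⟩
  have habs : |w i| = |w j| := by
    rw [sub_eq_zero.mp (hI'.symm.trans h0), abs_mul, abs_neg_one_pow, one_mul]
  by_cases hi : w i = 0
  · exact ⟨hi, by simpa [hi, eq_comm] using habs⟩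
  · have hj : w j ≠ 0 := abs_ne_zero.mp (habs ▸ abs_ne_zero.mpr hi)
    exact absurd habs (hwhet i j hij hi hj)
end
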